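/- Suppose B₁ and B₂ are both invertible d×d complex matrices each satisfying, together with A, the relations A*B_i + B_i*A = 2·I and AᵗB_i − B_iᵗA = 0 (i = 1, 2). Let φ₀^{(i)} and R_l^{(i)} denote the Gaussian and raising operators built from (A, B_i), and P_k^{(i)}(A,ℏ,x) = 2^{|k|/2} · ((R_1^{(i)})^{k_1} ∘ ⋯ ∘ (R_d^{(i)})^{k_d} φ₀^{(i)})(x) / φ₀^{(i)}(x). Then for every multi-index k ∈ ℕ^d and every x ∈ ℝ^d, P_k^{(1)}(A,ℏ,x) = P_k^{(2)}(A,ℏ,x); i.e. the polynomials P_k are independent of B. -/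

import Mathlib

open Matrix Complex

noncomputable section

/-- The pairing `⟨a, b⟩ = ∑ j, conj (a j) * b j` on `ℂ^d`. -/
def cinner {d : ℕ} (a b : Fin d → ℂ) : ℂ := ∑ j, (starRingEnd ℂ) (a j) * b j

/-- The embedding of `ℝ^d` into `ℂ^d`. -/
def cvec {d : ℕ} (x : Fin d → ℝ) : Fin d → ℂ := fun j => (x j : ℂ)

/-- The `l`-th standard basis vector of `ℂ^d`. -/
def stdC {d : ℕ} (l : Fin d) : Fin d → ℂ := Pi.single l 1

/-- The gradient of `ψ : ℝ^d → ℂ`, viewed as the vector of partial derivatives. -/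
def grad {d : ℕ} (ψ : (Fin d → ℝ) → ℂ) (x : Fin d → ℝ) : Fin d → ℂ :=
  fun j => fderiv ℝ ψ x (Pi.single j 1)

/-- The raising operator `R_l` built from `(A, B)` at semiclassical parameter `h`. -/
def raiseOp {d : ℕ} (A B : Matrix (Fin d) (Fin d) ℂ) (h : ℝ) (l : Fin d)
    (ψ : (Fin d → ℝ) → ℂ) : (Fin d → ℝ) → ℂ := fun x =>
  ((Real.sqrt (2 * h) : ℝ) : ℂ)⁻¹ *
    (cinner (B.mulVec (stdC l)) (cvec x) * ψ x
      - (h : ℂ) * cinner (A.mulVec (stdC l)) (grad ψ x))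

/-- The ground state Gaussian `φ₀`, where `sqrtA` is a fixed branch of `√(det A)`. -/
def phi0 {d : ℕ} (A B : Matrix (Fin d) (Fin d) ℂ) (h : ℝ) (sqrtA : ℂ)
    (x : Fin d → ℝ) : ℂ :=
  ((Real.pi ^ (-(d : ℝ) / 4) * h ^ (-(d : ℝ) / 4) : ℝ) : ℂ) * sqrtA⁻¹ *
    Complex.exp (-(cinner (cvec x) ((B * A⁻¹).mulVec (cvec x)) / ((2 * h : ℝ) : ℂ)))

/-- `R_1^{k_1} ∘ ⋯ ∘ R_d^{k_d}` for a family of operators `R` and a multi-index `k`. -/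
def opPow {d : ℕ} {α : Type*} (R : Fin d → (α → α)) (k : Fin d → ℕ) : α → α :=
  (List.finRange d).foldr (fun l f => (R l)^[k l] ∘ f) id

/-- The polynomials `P_k(A, h, x)`:
`P_k = 2^{|k|/2} (R_1^{k_1} ∘ ⋯ ∘ R_d^{k_d} φ₀)(x) / φ₀(x)`. -/
def Ppoly {d : ℕ} (A B : Matrix (Fin d) (Fin d) ℂ) (h : ℝ) (sqrtA : ℂ)
    (k : Fin d → ℕ) (x : Fin d → ℝ) : ℂ :=
  (((2 : ℝ) ^ (((∑ l, k l : ℕ) : ℝ) / 2) : ℝ) : ℂ) *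
    opPow (raiseOp A B h) k (phi0 A B h sqrtA) x / phi0 A B h sqrtA x

/-- The coordinate partial derivative `∂_j` acting on functions on `ℝ^d`. -/
def pdC {d : ℕ} (j : Fin d) (f : (Fin d → ℝ) → ℂ) : (Fin d → ℝ) → ℂ :=
  fun x => fderiv ℝ f x (Pi.single j 1)

/-- The generating function
`G(x,z) = exp(−⟨conj z, A⁻¹ conj(A) z⟩ + (2/√h) ⟨conj z, A⁻¹ x⟩)`. -/
def Gfun {d : ℕ} (A : Matrix (Fin d) (Fin d) ℂ) (h : ℝ) (x : Fin d → ℝ)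
    (z : Fin d → ℂ) : ℂ :=
  Complex.exp
    (-(cinner (fun j => (starRingEnd ℂ) (z j)) ((A⁻¹ * A.map (starRingEnd ℂ)).mulVec z))
      + (2 / ((Real.sqrt h : ℝ) : ℂ)) *
          cinner (fun j => (starRingEnd ℂ) (z j)) (A⁻¹.mulVec (cvec x)))

/-- The holomorphic partial derivative `∂/∂z_l` of a function on `ℂ^d`. -/
def dz {d : ℕ} (l : Fin d) (f : (Fin d → ℂ) → ℂ) : (Fin d → ℂ) → ℂ :=
  fun z => deriv (fun t => f (Function.update z l t)) (z l)


open scoped ContDiff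

lemma conj_cvec {d : ℕ} (x : Fin d → ℝ) (j : Fin d) :
    (starRingEnd ℂ) (cvec x j) = cvec x j := Complex.conj_ofReal _

lemma contDiff_cvec {d : ℕ} {n : WithTop ℕ∞} (j : Fin d) :
    ContDiff ℝ n fun x : Fin d → ℝ => cvec x j :=
  Complex.ofRealCLM.contDiff.comp (contDiff_apply ℝ ℝ j)

lemma cinner_cvec {d : ℕ} (x : Fin d → ℝ) (b : Fin d → ℂ) :
    cinner (cvec x) b = cvec x ⬝ᵥ b := by
  simp [cinner, dotProduct, conj_cvec]

lemma cinner_add_right {d : ℕ} (a b c : Fin d → ℂ) :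
    cinner a (b + c) = cinner a b + cinner a c := by
  simp [cinner, mul_add, Finset.sum_add_distrib]

lemma cinner_smul_right {d : ℕ} (a b : Fin d → ℂ) (t : ℂ) :
    cinner a (t • b) = t * cinner a b := by
  simp only [cinner, Finset.mul_sum, Pi.smul_apply, smul_eq_mul]
  exact Finset.sum_congr rfl fun j _ => by ring

lemma cinner_mulVec_stdC {d : ℕ} (M : Matrix (Fin d) (Fin d) ℂ) (l : Fin d)
    (v : Fin d → ℂ) : cinner (M *ᵥ stdC l) v = (Mᴴ *ᵥ v) l := by
  rw [stdC, mulVec_single_one]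
  simp [cinner, mulVec, dotProduct, conjTranspose_apply]

/-- The quadratic form in the exponent of the ground state. -/
def quadC {d : ℕ} (M : Matrix (Fin d) (Fin d) ℂ) (x : Fin d → ℝ) : ℂ :=
  cinner (cvec x) (M *ᵥ cvec x)

lemma contDiff_quadC {d : ℕ} (M : Matrix (Fin d) (Fin d) ℂ) : ContDiff ℝ ω (quadC M) := by
  unfold quadC
  simp only [cinner_cvec, dotProduct, mulVec]
  exact ContDiff.sum fun i _ => (contDiff_cvec i).mul
    (ContDiff.sum fun j _ => contDiff_const.mul (contDiff_cvec j))

lemma grad_quadC {d : ℕ} {M : Matrix (Fin d) (Fin d) ℂ} (hM : Mᵀ = M) (x : Fin d → ℝ) :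
    grad (quadC M) x = (2 : ℂ) • (M *ᵥ cvec x) := by
  funext j
  have hdiff : DifferentiableAt ℝ (quadC M) x := (contDiff_quadC M).differentiable (by simp) x
  have hline := hdiff.hasFDerivAt.hasLineDerivAt (Pi.single j (1 : ℝ))
  have hexp : (fun t : ℝ => quadC M (x + t • Pi.single j (1 : ℝ))) =
      fun t : ℝ => quadC M x + (t : ℂ) * (2 * (M *ᵥ cvec x) j) + (t : ℂ) ^ 2 * M j j := by
    funext t
    have hv : cvec (x + t • Pi.single j (1 : ℝ)) = cvec x + (t : ℂ) • Pi.single j (1 : ℂ) := by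
      funext i
      by_cases hij : i = j <;> simp [cvec, hij]
    have hsymm : cvec x ⬝ᵥ (M *ᵥ Pi.single j (1 : ℂ)) = (M *ᵥ cvec x) j := by
      rw [dotProduct_mulVec, ← mulVec_transpose, hM]
      simp
    rw [quadC, cinner_cvec, hv]
    simp only [quadC, cinner_cvec, mulVec_add, mulVec_smul, add_dotProduct, dotProduct_add,
      smul_dotProduct, dotProduct_smul, hsymm, smul_eq_mul, single_one_dotProduct]
    simp
    ring
  have hpoly : HasDerivAt (fun t : ℝ =>
      quadC M x + (t : ℂ) * (2 * (M *ᵥ cvec x) j) + (t : ℂ) ^ 2 * M j j)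
      (2 * (M *ᵥ cvec x) j) 0 := by
    have ht : HasDerivAt (fun t : ℝ => (t : ℂ)) 1 0 := Complex.ofRealCLM.hasDerivAt
    refine (((ht.mul_const (2 * (M *ᵥ cvec x) j)).const_add (quadC M x)).fun_add
      ((ht.fun_pow 2).mul_const (M j j))).congr_deriv ?_
    simp
  unfold HasLineDerivAt at hline
  rw [hexp] at hline
  exact hline.unique hpoly

lemma contDiff_phi0 {d : ℕ} (A B : Matrix (Fin d) (Fin d) ℂ) (h : ℝ) (s : ℂ) :
    ContDiff ℝ ω (phi0 A B h s) := by
  have hexp : ContDiff ℝ ω Complex.exp := Complex.contDiff_exp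
  exact contDiff_const.mul (hexp.comp ((contDiff_quadC (B * A⁻¹)).div_const _).neg)

lemma grad_phi0 {d : ℕ} {A B : Matrix (Fin d) (Fin d) ℂ} {h : ℝ} (s : ℂ)
    (hM : (B * A⁻¹)ᵀ = B * A⁻¹) (x : Fin d → ℝ) :
    grad (phi0 A B h s) x = (-phi0 A B h s x / h) • ((B * A⁻¹) *ᵥ cvec x) := by
  have hq : HasFDerivAt (quadC (B * A⁻¹)) (fderiv ℝ (quadC (B * A⁻¹)) x) x :=
    ((contDiff_quadC (B * A⁻¹)).differentiable (by simp) x).hasFDerivAt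
  have hφ := (((hq.mul_const (((2 * h : ℝ) : ℂ)⁻¹)).neg).cexp).const_mul
    (((Real.pi ^ (-(d : ℝ) / 4) * h ^ (-(d : ℝ) / 4) : ℝ) : ℂ) * s⁻¹)
  have hφ' : HasFDerivAt (phi0 A B h s) _ x := hφ
  funext j
  have hg : fderiv ℝ (quadC (B * A⁻¹)) x (Pi.single j 1) = 2 * ((B * A⁻¹) *ᵥ cvec x) j :=
    congrFun (grad_quadC hM x) j
  simp only [grad, hφ'.fderiv, phi0, quadC, div_eq_mul_inv]
  simp [hg]
  ring

/-- The raising operator conjugated by the ground state. -/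
def conjRaise {d : ℕ} (A : Matrix (Fin d) (Fin d) ℂ) (h : ℝ) (l : Fin d)
    (g : (Fin d → ℝ) → ℂ) : (Fin d → ℝ) → ℂ := fun x =>
  ((Real.sqrt (2 * h) : ℝ) : ℂ)⁻¹ *
    (2 * (A⁻¹ *ᵥ cvec x) l * g x - (h : ℂ) * cinner (A *ᵥ stdC l) (grad g x))

lemma contDiff_conjRaise {d : ℕ} (A : Matrix (Fin d) (Fin d) ℂ) (h : ℝ) (l : Fin d)
    {g : (Fin d → ℝ) → ℂ} (hg : ContDiff ℝ ∞ g) : ContDiff ℝ ∞ (conjRaise A h l g) := by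
  have hgrad (j : Fin d) : ContDiff ℝ ∞ fun x => grad g x j :=
    (hg.fderiv_right (m := ∞) (by simp)).clm_apply contDiff_const
  unfold conjRaise
  simp only [cinner, mulVec, dotProduct]
  refine contDiff_const.mul (((contDiff_const.mul ?_).mul hg).sub (contDiff_const.mul ?_))
  · exact ContDiff.sum fun j _ => contDiff_const.mul (contDiff_cvec j)
  · exact ContDiff.sum fun j _ => contDiff_const.mul (hgrad j)

lemma grad_mul {d : ℕ} {f g : (Fin d → ℝ) → ℂ} {x : Fin d → ℝ}
    (hf : DifferentiableAt ℝ f x) (hg : DifferentiableAt ℝ g x) :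
    grad (f * g) x = f x • grad g x + g x • grad f x := by
  funext j
  simp [grad, fderiv_mul hf hg]

section Relations

variable {d : ℕ} {A B : Matrix (Fin d) (Fin d) ℂ} {h : ℝ}

lemma transpose_mul_inv_eq (hA : IsUnit A.det) (hAB : Aᵀ * B - Bᵀ * A = 0) :
    (B * A⁻¹)ᵀ = B * A⁻¹ := by
  have hAt : IsUnit Aᵀ.det := by rwa [det_transpose]
  rw [transpose_mul, transpose_nonsing_inv]
  calc Aᵀ⁻¹ * Bᵀ = Aᵀ⁻¹ * (Bᵀ * A) * A⁻¹ := by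
        rw [← Matrix.mul_assoc, mul_nonsing_inv_cancel_right _ _ hA]
    _ = B * A⁻¹ := by
        rw [← sub_eq_zero.mp hAB, nonsing_inv_mul_cancel_left _ _ hAt]

lemma conjTranspose_add_mul_inv (hA : IsUnit A.det)
    (hAB : Aᴴ * B + Bᴴ * A = (2 : ℂ) • (1 : Matrix (Fin d) (Fin d) ℂ)) :
    Bᴴ + Aᴴ * (B * A⁻¹) = (2 : ℂ) • A⁻¹ := by
  calc Bᴴ + Aᴴ * (B * A⁻¹) = (Aᴴ * B + Bᴴ * A) * A⁻¹ := by
        rw [Matrix.add_mul, mul_nonsing_inv_cancel_right _ _ hA, Matrix.mul_assoc, add_comm]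
    _ = (2 : ℂ) • A⁻¹ := by rw [hAB, Matrix.smul_mul, Matrix.one_mul]

lemma raiseOp_phi0_mul (hh : 0 < h) (hA : IsUnit A.det)
    (hAB₁ : Aᴴ * B + Bᴴ * A = (2 : ℂ) • (1 : Matrix (Fin d) (Fin d) ℂ))
    (hAB₂ : Aᵀ * B - Bᵀ * A = 0) (s : ℂ) (l : Fin d)
    {g : (Fin d → ℝ) → ℂ} (hg : ContDiff ℝ ∞ g) :
    raiseOp A B h l (phi0 A B h s * g) = phi0 A B h s * conjRaise A h l g := by
  funext x
  have hh' : (h : ℂ) ≠ 0 := Complex.ofReal_ne_zero.mpr hh.ne'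
  have key : (Bᴴ *ᵥ cvec x) l + (Aᴴ *ᵥ ((B * A⁻¹) *ᵥ cvec x)) l = 2 * (A⁻¹ *ᵥ cvec x) l := by
    have := congrFun (congrArg (· *ᵥ cvec x) (conjTranspose_add_mul_inv hA hAB₁)) l
    simpa [add_mulVec, smul_mulVec, mulVec_mulVec] using this
  simp only [raiseOp, conjRaise, Pi.mul_apply,
    grad_mul ((contDiff_phi0 A B h s).differentiable (by simp) x)
      (hg.differentiable (by simp) x),
    grad_phi0 s (transpose_mul_inv_eq hA hAB₂), cinner_add_right, cinner_smul_right, ← key]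
  simp only [cinner_mulVec_stdC]
  field_simp
  ring

lemma iterate_raiseOp_phi0_mul (hh : 0 < h) (hA : IsUnit A.det)
    (hAB₁ : Aᴴ * B + Bᴴ * A = (2 : ℂ) • (1 : Matrix (Fin d) (Fin d) ℂ))
    (hAB₂ : Aᵀ * B - Bᵀ * A = 0) (s : ℂ) (l : Fin d) (n : ℕ)
    {g : (Fin d → ℝ) → ℂ} (hg : ContDiff ℝ ∞ g) :
    ContDiff ℝ ∞ ((conjRaise A h l)^[n] g) ∧
      (raiseOp A B h l)^[n] (phi0 A B h s * g) =
        phi0 A B h s * (conjRaise A h l)^[n] g := by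
  induction n with
  | zero => exact ⟨hg, rfl⟩
  | succ n ih =>
    simp only [Function.iterate_succ_apply', ih.2]
    exact ⟨contDiff_conjRaise A h l ih.1, raiseOp_phi0_mul hh hA hAB₁ hAB₂ s l ih.1⟩

lemma opPow_raiseOp_phi0 (hh : 0 < h) (hA : IsUnit A.det)
    (hAB₁ : Aᴴ * B + Bᴴ * A = (2 : ℂ) • (1 : Matrix (Fin d) (Fin d) ℂ))
    (hAB₂ : Aᵀ * B - Bᵀ * A = 0) (s : ℂ) (k : Fin d → ℕ) :
    opPow (raiseOp A B h) k (phi0 A B h s) =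
      phi0 A B h s * opPow (conjRaise A h) k 1 := by
  suffices H : ∀ L : List (Fin d),
      ContDiff ℝ ∞ (L.foldr (fun l f => (conjRaise A h l)^[k l] ∘ f) id 1) ∧
      L.foldr (fun l f => (raiseOp A B h l)^[k l] ∘ f) id (phi0 A B h s) =
        phi0 A B h s * L.foldr (fun l f => (conjRaise A h l)^[k l] ∘ f) id 1 from
    (H (List.finRange d)).2
  intro L
  induction L with
  | nil => exact ⟨contDiff_const, (mul_one _).symm⟩
  | cons l L ih =>
    simp only [List.foldr_cons, Function.comp_apply, ih.2]
    exact iterate_raiseOp_phi0_mul hh hA hAB₁ hAB₂ s l (k l) ih.1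

lemma phi0_ne_zero (hh : 0 < h) {s : ℂ} (hs : s ≠ 0) (x : Fin d → ℝ) :
    phi0 A B h s x ≠ 0 :=
  mul_ne_zero (mul_ne_zero (Complex.ofReal_ne_zero.mpr (by positivity)) (inv_ne_zero hs))
    (Complex.exp_ne_zero _)

lemma Ppoly_eq_conjRaise (hh : 0 < h) (hA : IsUnit A.det)
    (hAB₁ : Aᴴ * B + Bᴴ * A = (2 : ℂ) • (1 : Matrix (Fin d) (Fin d) ℂ))
    (hAB₂ : Aᵀ * B - Bᵀ * A = 0) {s : ℂ} (hs : s ≠ 0) (k : Fin d → ℕ) (x : Fin d → ℝ) :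
    Ppoly A B h s k x =
      (((2 : ℝ) ^ (((∑ l, k l : ℕ) : ℝ) / 2) : ℝ) : ℂ) * opPow (conjRaise A h) k 1 x := by
  rw [Ppoly, opPow_raiseOp_phi0 hh hA hAB₁ hAB₂, Pi.mul_apply, mul_div_assoc,
    mul_div_cancel_left₀ _ (phi0_ne_zero hh hs x)]

end Relations

/-- The polynomials `P_k` are independent of the choice of `B`. -/
theorem Ppoly_independent_of_B
    {d : ℕ} (hd : 1 ≤ d) {hbar : ℝ} (hhbar : 0 < hbar)
    (A B₁ B₂ : Matrix (Fin d) (Fin d) ℂ) (hA : IsUnit A.det)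
    (hB₁ : IsUnit B₁.det) (hB₂ : IsUnit B₂.det)
    (hAB₁₁ : Aᴴ * B₁ + B₁ᴴ * A = (2 : ℂ) • (1 : Matrix (Fin d) (Fin d) ℂ))
    (hAB₁₂ : Aᵀ * B₁ - B₁ᵀ * A = 0)
    (hAB₂₁ : Aᴴ * B₂ + B₂ᴴ * A = (2 : ℂ) • (1 : Matrix (Fin d) (Fin d) ℂ))
    (hAB₂₂ : Aᵀ * B₂ - B₂ᵀ * A = 0)
    (sqrtA : ℂ) (hsqrtA : sqrtA ^ 2 = A.det)
    (k : Fin d → ℕ) (x : Fin d → ℝ) :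
    Ppoly A B₁ hbar sqrtA k x = Ppoly A B₂ hbar sqrtA k x := by
  have hs : sqrtA ≠ 0 := by
    rintro rfl
    exact hA.ne_zero (by simpa using hsqrtA.symm)
  rw [Ppoly_eq_conjRaise hhbar hA hAB₁₁ hAB₁₂ hs, Ppoly_eq_conjRaise hhbar hA hAB₂₁ hAB₂₂ hs]

end
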